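/- arXiv:1401.6739 — 2 statements merged into one kernel-verified Lean document; each statement's English description precedes it below -/
import Mathlib

section
/- Let E: ℝᴺ → [0,∞) be smooth with E(0) = 0, 0 the unique minimum, D²E(0) > 0 nondegenerate, liminf_{|x|→∞} E(x) > 0, and e^{−λE} integrable for all λ > 0. Then lim_{λ→∞} (λ/(2π))^{N/2} ∫_{ℝᴺ} e^{−λE(x)} dx = det(D²E(0))^{−1/2}. -/
open MeasureTheory

open Filter Topology Asymptotics
open scoped Matrix MatrixOrder

/-- Second-order Taylor expansion with Peano remainder. -/
theorem ContDiff.taylor_two_isLittleO {V F : Type*} [NormedAddCommGroup V] [NormedSpace ℝ V]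
    [NormedAddCommGroup F] [NormedSpace ℝ F] {f : V → F} (hf : ContDiff ℝ 2 f) (x : V) :
    (fun h => f (x + h) - f x - fderiv ℝ f x h - (1 / 2 : ℝ) • fderiv ℝ (fderiv ℝ f) x h h)
      =o[𝓝 0] fun h => ‖h‖ ^ 2 := by
  have hdf : Differentiable ℝ f := hf.differentiable (by norm_num)
  have hddf : DifferentiableAt ℝ (fderiv ℝ f) x :=
    (hf.fderiv_right (m := 1) (by norm_num)).differentiable (by norm_num) x
  have hsymm : IsSymmSndFDerivAt ℝ f x :=
    hf.contDiffAt.isSymmSndFDerivAt (by simp [minSmoothness_of_isRCLikeNormedField])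
  set A := fderiv ℝ f x
  set B := fderiv ℝ (fderiv ℝ f) x
  refine isLittleO_iff.2 fun ε hε => ?_
  have hlo := (hasFDerivAt_iff_isLittleO_nhds_zero.1 hddf.hasFDerivAt).def hε
  obtain ⟨δ, hδ, hball⟩ := Metric.eventually_nhds_iff_ball.1 hlo
  refine Metric.eventually_nhds_iff_ball.2 ⟨δ, hδ, fun h hh => ?_⟩
  have hderiv : ∀ k, HasFDerivAt
      (fun h => f (x + h) - f x - A h - (1 / 2 : ℝ) • B h h)
      (fderiv ℝ f (x + k) - A - B k) k := by
    intro k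
    have h₁ : HasFDerivAt (fun h => f (x + h)) (fderiv ℝ f (x + k)) k := by
      simpa [Function.comp_def] using
        (hdf (x + k)).hasFDerivAt.comp k ((hasFDerivAt_id k).const_add x)
    have h₂ := (B.hasFDerivAt (x := k)).clm_apply (hasFDerivAt_id k)
    refine (((h₁.sub_const (f x)).sub A.hasFDerivAt).sub (h₂.const_smul (1 / 2 : ℝ))).congr_fderiv
      ?_
    ext v
    have hs : B v k = B k v := hsymm v k
    simp only [ContinuousLinearMap.comp_id, id_eq, sub_apply, smul_apply, add_apply,
      ContinuousLinearMap.flip_apply, hs]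
    rw [← two_smul ℝ (B k v), smul_smul]
    norm_num
  have key := Convex.norm_image_sub_le_of_norm_hasFDerivWithin_le (C := ε * ‖h‖)
    (s := Metric.closedBall (0 : V) ‖h‖) (x := 0) (y := h)
    (fun k _ => (hderiv k).hasFDerivWithinAt)
    (fun k hk => ?_) (convex_closedBall _ _) (by simp) (by simp)
  · simpa [pow_two, mul_assoc] using key
  · have hk' : ‖k‖ ≤ ‖h‖ := by simpa using hk
    refine (hball k ?_).trans (by gcongr)
    simp only [Metric.mem_ball, dist_zero_right] at hh ⊢
    exact hk'.trans_lt hh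

/-- A positive definite continuous bilinear form on a finite-dimensional space is coercive. -/
theorem ContinuousLinearMap.exists_pos_mul_sq_norm_le {V : Type*} [NormedAddCommGroup V]
    [NormedSpace ℝ V] [FiniteDimensional ℝ V] (B : V →L[ℝ] V →L[ℝ] ℝ)
    (hB : ∀ v, v ≠ 0 → 0 < B v v) : ∃ c > 0, ∀ v, c * ‖v‖ ^ 2 ≤ B v v := by
  obtain ⟨c, hc, h⟩ := (isCompact_sphere (0 : V) 1).exists_forall_le'
    (f := fun v => B v v) (by fun_prop) (a := 0)
    (fun v hv => hB v (ne_zero_of_mem_unit_sphere ⟨v, hv⟩))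
  refine ⟨c, hc, fun v => ?_⟩
  rcases eq_or_ne v 0 with rfl | hv
  · simp
  have hv' : 0 < ‖v‖ := norm_pos_iff.2 hv
  have := h (‖v‖⁻¹ • v) (by simp [norm_smul, hv'.ne'])
  simp only [map_smul, smul_apply, smul_eq_mul] at this
  calc c * ‖v‖ ^ 2 ≤ (‖v‖⁻¹ * (‖v‖⁻¹ * B v v)) * ‖v‖ ^ 2 := by gcongr
    _ = B v v := by field_simp

theorem integrable_rexp_neg_mul_sq_norm {V : Type*} [NormedAddCommGroup V]
    [InnerProductSpace ℝ V] [FiniteDimensional ℝ V] [MeasurableSpace V] [BorelSpace V]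
    {b : ℝ} (hb : 0 < b) : Integrable fun v : V => Real.exp (-b * ‖v‖ ^ 2) := by
  refine .of_integral_ne_zero ?_
  rw [GaussianFourier.integral_rexp_neg_mul_sq_norm hb]
  positivity

/-- The Gaussian integral of a positive definite quadratic form. -/
theorem Matrix.PosDef.integral_rexp_neg_half_dotProduct {ι : Type*} [Fintype ι] [DecidableEq ι]
    {M : Matrix ι ι ℝ} (hM : M.PosDef) :
    ∫ v : EuclideanSpace ℝ ι, Real.exp (-(1 / 2 * (v.ofLp ⬝ᵥ M *ᵥ v.ofLp))) =
      (2 * Real.pi) ^ ((Fintype.card ι : ℝ) / 2) * M.det ^ (-(1 : ℝ) / 2) := by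
  obtain ⟨S, rfl⟩ : ∃ S : Matrix ι ι ℝ, M = Sᵀ * S := by
    obtain ⟨S, hS⟩ := CStarAlgebra.nonneg_iff_eq_star_mul_self.mp hM.posSemidef.nonneg
    exact ⟨S, by simpa [Matrix.star_eq_conjTranspose] using hS⟩
  have hdet : S.det ≠ 0 := by
    intro h
    simpa [h] using hM.det_pos
  set L := Matrix.toEuclideanLin S
  have hL : LinearMap.det L = S.det := LinearMap.det_toLpLin 2 S
  have hq : ∀ v : EuclideanSpace ℝ ι,
      Real.exp (-(1 / 2 * (v.ofLp ⬝ᵥ (Sᵀ * S) *ᵥ v.ofLp))) =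
        Real.exp (-(1 / 2) * ‖L v‖ ^ 2) := by
    intro v
    rw [EuclideanSpace.real_norm_sq_eq, ← Matrix.mulVec_mulVec, Matrix.dotProduct_mulVec,
      Matrix.vecMul_transpose, neg_mul]
    simp [L, dotProduct, pow_two, Matrix.toLpLin_apply]
  simp_rw [hq]
  have hmap := Measure.map_linearMap_addHaar_eq_smul_addHaar
    (volume : Measure (EuclideanSpace ℝ ι)) (f := L) (hL ▸ hdet)
  have hint := integral_map (μ := (volume : Measure (EuclideanSpace ℝ ι))) (φ := L)
    L.continuous_of_finiteDimensional.aemeasurable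
    (f := fun w => Real.exp (-(1 / 2) * ‖w‖ ^ 2))
    (Continuous.aestronglyMeasurable (by fun_prop))
  rw [← hint, hmap, integral_smul_measure,
    GaussianFourier.integral_rexp_neg_mul_sq_norm (by norm_num), hL, finrank_euclideanSpace,
    ENNReal.toReal_ofReal (abs_nonneg _), smul_eq_mul, mul_comm]
  congr 1
  · congr 1
    ring
  · rw [Matrix.det_mul, Matrix.det_transpose, ← abs_mul_abs_self, neg_div, Real.rpow_neg
      (by positivity), ← Real.sqrt_eq_rpow, Real.sqrt_mul_self (abs_nonneg _), abs_inv]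

section Laplace

variable {V : Type*} [NormedAddCommGroup V] [InnerProductSpace ℝ V] [FiniteDimensional ℝ V]
  [MeasurableSpace V] [BorelSpace V]

/-- Laplace's method on a ball on which `E` has quadratic growth. -/
theorem tendsto_rpow_mul_setIntegral_ball_exp {E : V → ℝ} (hE : Continuous E)
    {B : V →L[ℝ] V →L[ℝ] ℝ} {r c : ℝ} (hr : 0 < r) (hc : 0 < c)
    (hlo : (fun x => E x - 1 / 2 * B x x) =o[𝓝 0] fun x => ‖x‖ ^ 2)
    (hgrowth : ∀ x ∈ Metric.ball (0 : V) r, c * ‖x‖ ^ 2 ≤ E x) :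
    Tendsto (fun l : ℝ => l ^ ((Module.finrank ℝ V : ℝ) / 2) *
        ∫ x in Metric.ball (0 : V) r, Real.exp (-l * E x)) atTop
      (𝓝 (∫ x, Real.exp (-(1 / 2 * B x x)))) := by
  set F : ℝ → V → ℝ := fun l => (Metric.ball (0 : V) r).indicator fun x => Real.exp (-l * E x)
  have hscale : ∀ l : ℝ, 0 < l → l ^ ((Module.finrank ℝ V : ℝ) / 2) *
      ∫ x in Metric.ball (0 : V) r, Real.exp (-l * E x) = ∫ y, F l ((√l)⁻¹ • y) := by
    intro l hl
    rw [Measure.integral_comp_inv_smul, smul_eq_mul, abs_of_nonneg (by positivity),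
      integral_indicator measurableSet_ball, Real.sqrt_eq_rpow, ← Real.rpow_mul_natCast hl.le]
    ring_nf
  have hbig : ∀ᶠ l : ℝ in atTop, 0 < l := eventually_gt_atTop 0
  refine Tendsto.congr' (hbig.mono fun l hl => (hscale l hl).symm) ?_
  have hinv : Tendsto (fun l : ℝ => (√l)⁻¹) atTop (𝓝 0) :=
    tendsto_inv_atTop_zero.comp Real.tendsto_sqrt_atTop
  refine tendsto_integral_filter_of_dominated_convergence
    (fun y => Real.exp (-c * ‖y‖ ^ 2)) (Eventually.of_forall fun l => ?_) ?_
    (integrable_rexp_neg_mul_sq_norm hc) (Eventually.of_forall fun y => ?_)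
  · refine Measurable.aestronglyMeasurable ?_
    refine Measurable.comp (g := F l) ?_ (measurable_const_smul _)
    exact (Continuous.measurable (by fun_prop)).indicator measurableSet_ball
  · filter_upwards [hbig] with l hl
    refine Eventually.of_forall fun y => ?_
    by_cases hy : (√l)⁻¹ • y ∈ Metric.ball (0 : V) r
    · simp only [F, Set.indicator_of_mem hy, Real.norm_eq_abs, Real.abs_exp]
      have h := mul_le_mul_of_nonneg_left (hgrowth _ hy) hl.le
      rw [norm_smul, mul_pow, norm_inv, Real.norm_eq_abs, inv_pow, sq_abs, Real.sq_sqrt hl.le] at h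
      have : l * (c * (l⁻¹ * ‖y‖ ^ 2)) = c * ‖y‖ ^ 2 := by field_simp
      exact Real.exp_le_exp.2 (by linarith)
    · simp only [F, Set.indicator_of_notMem hy, norm_zero]
      positivity
  · have hy : Tendsto (fun l : ℝ => (√l)⁻¹ • y) atTop (𝓝 0) := by
      simpa using hinv.smul_const y
    have hrem : Tendsto (fun l : ℝ => l * (E ((√l)⁻¹ • y) -
        1 / 2 * B ((√l)⁻¹ • y) ((√l)⁻¹ • y))) atTop (𝓝 0) := by
      refine (isLittleO_one_iff ℝ).1 ?_
      refine ((isBigO_refl (fun l : ℝ => l) atTop).mul_isLittleO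
        (hlo.comp_tendsto hy)).trans_isBigO ?_
      refine IsBigO.of_bound (‖y‖ ^ 2) (hbig.mono fun l hl => le_of_eq ?_)
      simp only [Function.comp_apply, norm_smul, mul_pow, norm_inv, Real.norm_eq_abs, inv_pow,
        sq_abs, Real.sq_sqrt hl.le]
      rw [mul_inv_cancel_left₀ hl.ne']
      simp
    have hexp : Tendsto (fun l : ℝ => Real.exp (-(l * (E ((√l)⁻¹ • y) -
        1 / 2 * B ((√l)⁻¹ • y) ((√l)⁻¹ • y)) + 1 / 2 * B y y))) atTop
        (𝓝 (Real.exp (-(1 / 2 * B y y)))) := by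
      simpa [Function.comp_def, add_comm] using (Real.continuous_exp.tendsto _).comp (hrem.add_const (1 / 2 * B y y)).neg
    refine hexp.congr' ?_
    filter_upwards [hbig, hy.eventually (Metric.ball_mem_nhds 0 hr)] with l hl hl'
    have hB : l * B ((√l)⁻¹ • y) ((√l)⁻¹ • y) = B y y := by
      simp only [map_smul, smul_apply, smul_eq_mul]
      rw [← mul_assoc (√l)⁻¹, ← mul_inv, Real.mul_self_sqrt hl.le, mul_inv_cancel_left₀ hl.ne']
    simp only [F, Set.indicator_of_mem (Metric.mem_ball.2 hl')]
    congr 1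
    linear_combination (1 / 2) * hB

/-- The region where `E` is bounded below by a positive constant contributes nothing. -/
theorem tendsto_rpow_mul_setIntegral_exp_zero {Ω : Type*} [MeasurableSpace Ω] {μ : Measure Ω}
    {E : Ω → ℝ} {s : Set Ω} (hs : MeasurableSet s) {δ : ℝ} (hδ : 0 < δ) (hE : ∀ x ∈ s, δ ≤ E x)
    (hint : ∀ l : ℝ, 0 < l → Integrable (fun x => Real.exp (-l * E x)) μ) (p : ℝ) :
    Tendsto (fun l : ℝ => l ^ p * ∫ x in s, Real.exp (-l * E x) ∂μ) atTop (𝓝 0) := by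
  have hlim : Tendsto (fun l : ℝ => l ^ p * Real.exp (-δ * l) *
      (Real.exp δ * ∫ x in s, Real.exp (-1 * E x) ∂μ)) atTop (𝓝 0) := by
    simpa using (tendsto_rpow_mul_exp_neg_mul_atTop_nhds_zero p δ hδ).mul_const
      (Real.exp δ * ∫ x in s, Real.exp (-1 * E x) ∂μ)
  refine squeeze_zero' ?_ ?_ hlim
  · filter_upwards [eventually_ge_atTop 0] with l hl
    exact mul_nonneg (Real.rpow_nonneg hl p) (integral_nonneg fun x => (Real.exp_pos _).le)
  · filter_upwards [eventually_ge_atTop 1] with l hl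
    rw [mul_assoc]
    refine mul_le_mul_of_nonneg_left ?_ (Real.rpow_nonneg (zero_le_one.trans hl) p)
    rw [← mul_assoc, ← integral_const_mul]
    refine setIntegral_mono_on (hint l (by linarith)).integrableOn
      ((hint 1 one_pos).integrableOn.const_mul _) hs fun x hx => ?_
    rw [← Real.exp_add, ← Real.exp_add]
    refine Real.exp_le_exp.2 ?_
    nlinarith [mul_le_mul_of_nonneg_left (hE x hx) (sub_nonneg.2 hl)]

/-- Laplace's method for a function with a nondegenerate global minimum at the origin. -/
theorem tendsto_rpow_mul_integral_exp {E : V → ℝ} (hE : Continuous E)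
    {B : V →L[ℝ] V →L[ℝ] ℝ} (hB : ∀ v, v ≠ 0 → 0 < B v v)
    (hlo : (fun x => E x - 1 / 2 * B x x) =o[𝓝 0] fun x => ‖x‖ ^ 2)
    (hmin : ∀ x, x ≠ 0 → 0 < E x) (hinf : ∃ c > (0 : ℝ), ∃ R : ℝ, ∀ x, R ≤ ‖x‖ → c ≤ E x)
    (hint : ∀ l : ℝ, 0 < l → Integrable fun x => Real.exp (-l * E x)) :
    Tendsto (fun l : ℝ => l ^ ((Module.finrank ℝ V : ℝ) / 2) * ∫ x, Real.exp (-l * E x)) atTop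
      (𝓝 (∫ x, Real.exp (-(1 / 2 * B x x)))) := by
  obtain ⟨c, hc, hcB⟩ := B.exists_pos_mul_sq_norm_le hB
  obtain ⟨r, hr, hball⟩ := Metric.eventually_nhds_iff_ball.1 (hlo.def (c := c / 4) (by positivity))
  have hgrowth : ∀ x ∈ Metric.ball (0 : V) r, c / 4 * ‖x‖ ^ 2 ≤ E x := by
    intro x hx
    have h₁ := (abs_le.1 (hball x hx)).1
    rw [norm_pow, norm_norm] at h₁
    linarith [hcB x]
  obtain ⟨c', hc', R, hR⟩ := hinf
  obtain ⟨a, ha, hK⟩ := ((isCompact_closedBall (0 : V) R).diff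
    (Metric.isOpen_ball (x := 0) (ε := r))).exists_forall_le' hE.continuousOn (a := 0)
    (fun x hx => hmin x fun h => hx.2 (by simpa [h] using hr))
  have hfar : ∀ x ∈ (Metric.ball (0 : V) r)ᶜ, min a c' ≤ E x := by
    intro x hx
    rcases le_total R ‖x‖ with h | h
    · exact (min_le_right _ _).trans (hR x h)
    · exact (min_le_left _ _).trans (hK x ⟨by simpa using h, hx⟩)
  have h := (tendsto_rpow_mul_setIntegral_ball_exp hE hr (by positivity) hlo hgrowth).add
    (tendsto_rpow_mul_setIntegral_exp_zero measurableSet_ball.compl (lt_min ha hc') hfar hint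
      ((Module.finrank ℝ V : ℝ) / 2))
  rw [add_zero] at h
  refine h.congr' ?_
  filter_upwards [eventually_gt_atTop 0] with l hl
  rw [← mul_add, integral_add_compl measurableSet_ball (hint l hl)]

end Laplace

theorem ContinuousLinearMap.apply_apply_eq_dotProduct {ι : Type*} [Fintype ι] [DecidableEq ι]
    (B : EuclideanSpace ℝ ι →L[ℝ] EuclideanSpace ℝ ι →L[ℝ] ℝ) (v : EuclideanSpace ℝ ι) :
    B v v = v.ofLp ⬝ᵥ (Matrix.of fun i j => B (EuclideanSpace.single i 1)
      (EuclideanSpace.single j 1)) *ᵥ v.ofLp := by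
  have hv : v = ∑ i, v i • EuclideanSpace.single i (1 : ℝ) := by
    simpa using ((EuclideanSpace.basisFun ι ℝ).sum_repr v).symm
  conv_lhs => rw [hv]
  simp only [map_sum, map_smul, sum_apply, smul_apply,
    smul_eq_mul, dotProduct, Matrix.mulVec, Matrix.of_apply, Finset.mul_sum]
  rw [Finset.sum_comm]
  refine Finset.sum_congr rfl fun i _ => Finset.sum_congr rfl fun j _ => ?_
  ring

/-- Laplace's method for the normalization constant of the Gibbs measure:
`lim_{λ→∞} (λ/(2π))^{N/2} ∫ e^{−λE} dx = det(D²E(0))^{−1/2}`. -/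
theorem laplace_method_normalization
    (N : ℕ) (E : EuclideanSpace ℝ (Fin N) → ℝ)
    (hsm : ContDiff ℝ (⊤ : ℕ∞) E) (hnonneg : ∀ x, 0 ≤ E x) (hE0 : E 0 = 0)
    (hmin : ∀ x, x ≠ 0 → 0 < E x)
    (hhess : ∀ v : EuclideanSpace ℝ (Fin N), v ≠ 0 → 0 < iteratedFDeriv ℝ 2 E 0 ![v, v])
    (hliminf : ∃ c > (0:ℝ), ∃ R : ℝ, ∀ x, R ≤ ‖x‖ → c ≤ E x)
    (hint : ∀ l : ℝ, 0 < l → Integrable (fun x => Real.exp (-l * E x))) :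
    Filter.Tendsto
      (fun l : ℝ => (l / (2 * Real.pi)) ^ ((N : ℝ) / 2) * ∫ x, Real.exp (-l * E x))
      Filter.atTop
      (nhds ((Matrix.det (Matrix.of fun i j : Fin N =>
        iteratedFDeriv ℝ 2 E 0 ![EuclideanSpace.single i 1, EuclideanSpace.single j 1]))
          ^ (-(1:ℝ) / 2))) := by
  have hsm2 : ContDiff ℝ 2 E := hsm.of_le (WithTop.coe_le_coe.2 le_top)
  set B := fderiv ℝ (fderiv ℝ E) 0
  simp only [iteratedFDeriv_two_apply, Matrix.cons_val_zero, Matrix.cons_val_one] at hhess ⊢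
  have hcrit : fderiv ℝ E 0 = 0 :=
    IsLocalMin.fderiv_eq_zero (Eventually.of_forall fun x => by simpa [hE0] using hnonneg x)
  have hlo : (fun x => E x - 1 / 2 * B x x) =o[𝓝 0] fun x => ‖x‖ ^ 2 := by
    simpa [hE0, hcrit] using hsm2.taylor_two_isLittleO 0
  have hsymm : IsSymmSndFDerivAt ℝ E 0 :=
    hsm2.contDiffAt.isSymmSndFDerivAt (by simp [minSmoothness_of_isRCLikeNormedField])
  have hM : (Matrix.of fun i j : Fin N =>
      B (EuclideanSpace.single i 1) (EuclideanSpace.single j 1)).PosDef := by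
    refine .of_dotProduct_mulVec_pos (Matrix.IsHermitian.ext fun i j => ?_) fun x hx => ?_
    · exact hsymm _ _
    · have h := hhess (WithLp.toLp 2 x) (by simpa using hx)
      rw [B.apply_apply_eq_dotProduct] at h
      simpa using h
  have hlim := tendsto_rpow_mul_integral_exp hsm.continuous hhess hlo hmin hliminf hint
  have hgauss : ∫ x, Real.exp (-(1 / 2 * B x x)) = _ :=
    (integral_congr_ae (Eventually.of_forall fun x => by
      simp only [B.apply_apply_eq_dotProduct x])).trans hM.integral_rexp_neg_half_dotProduct
  rw [hgauss, finrank_euclideanSpace, Fintype.card_fin] at hlim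
  have hpi : (0 : ℝ) < (2 * Real.pi) ^ ((N : ℝ) / 2) := by positivity
  have hlim' := hlim.const_mul ((2 * Real.pi) ^ ((N : ℝ) / 2))⁻¹
  rw [inv_mul_cancel_left₀ hpi.ne'] at hlim'
  refine hlim'.congr' ?_
  filter_upwards [eventually_ge_atTop 0] with l hl
  rw [Real.div_rpow hl (by positivity)]
  ring
end

section
/- Let f: [0,1] → M_n(ℝ) be C² with f(t) invertible for 0 ≤ t < 1, f(1) = 0, f'(1) = −I, satisfying f''(t) + R(t)f(t) = 0 with R(t) symmetric, and assume f'(t)f(t)^{−1} is symmetric for each t. Define S on L²₀ = {φ ∈ L²([0,1],ℝⁿ) : ∫₀¹φ = 0} by (Sφ)(t) = φ(t) − f'(t)f(t)^{−1} ∫₀ᵗ φ(s) ds, and define T on L²₀ by (Tφ)(t) = −∫ₜ¹ R(s)(∫₀ˢ φ(u) du) ds + ∫₀¹ (∫ₜ¹ R(s)(∫₀ˢ φ(u)du) ds) dt. Then T is symmetric and ‖Sφ‖²_{L²} = ((I+T)φ, φ)_{L²} for all φ ∈ L²₀. -/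
open MeasureTheory intervalIntegral
open scoped RealInnerProductSpace

attribute [local instance] Matrix.normedAddCommGroup Matrix.normedSpace

noncomputable section

/-- The operator `(Sφ)(t) = φ(t) − f'(t) f(t)⁻¹ ∫₀ᵗ φ(s) ds`. -/
def Sop (n : ℕ) (f f' : ℝ → Matrix (Fin n) (Fin n) ℝ)
    (φ : ℝ → EuclideanSpace ℝ (Fin n)) (t : ℝ) : EuclideanSpace ℝ (Fin n) :=
  φ t - (EuclideanSpace.equiv (Fin n) ℝ).symm
    ((f' t * (f t)⁻¹).mulVec (EuclideanSpace.equiv (Fin n) ℝ (∫ s in (0:ℝ)..t, φ s)))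

/-- The operator
`(Tφ)(t) = −∫ₜ¹ R(s)(∫₀ˢ φ(u) du) ds + ∫₀¹ (∫ₜ¹ R(s)(∫₀ˢ φ(u) du) ds) dt`. -/
def Thess (n : ℕ) (R : ℝ → Matrix (Fin n) (Fin n) ℝ)
    (φ : ℝ → EuclideanSpace ℝ (Fin n)) (t : ℝ) : EuclideanSpace ℝ (Fin n) :=
  -(∫ s in t..1, (EuclideanSpace.equiv (Fin n) ℝ).symm
      ((R s).mulVec (EuclideanSpace.equiv (Fin n) ℝ (∫ u in (0:ℝ)..s, φ u))))
    + ∫ t' in (0:ℝ)..1, ∫ s in t'..1, (EuclideanSpace.equiv (Fin n) ℝ).symm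
        ((R s).mulVec (EuclideanSpace.equiv (Fin n) ℝ (∫ u in (0:ℝ)..s, φ u)))

section
variable {X : Type*} [PseudoMetricSpace X] {Y : Type*} [PseudoMetricSpace Y]
  {Z : Type*} [PseudoMetricSpace Z] {a b : ℝ}

theorem AbsolutelyContinuousOnInterval.of_dist_le {f : ℝ → X} {g : ℝ → Y} {h : ℝ → Z} {C D : ℝ}
    (hg : AbsolutelyContinuousOnInterval g a b) (hh : AbsolutelyContinuousOnInterval h a b)
    (hle : ∀ x ∈ Set.uIcc a b, ∀ y ∈ Set.uIcc a b,
      dist (f x) (f y) ≤ C * dist (g x) (g y) + D * dist (h x) (h y)) :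
    AbsolutelyContinuousOnInterval f a b := by
  unfold AbsolutelyContinuousOnInterval at hg hh ⊢
  refine squeeze_zero' ?_ ?_ (by simpa using (hg.const_mul C).add (hh.const_mul D))
  · exact Filter.Eventually.of_forall fun _ ↦ Finset.sum_nonneg fun i _ ↦ dist_nonneg
  rw [Filter.eventually_inf_principal]
  filter_upwards with I hI
  simp only [Finset.mul_sum, ← Finset.sum_add_distrib]
  exact Finset.sum_le_sum fun i hi ↦ hle _ (hI.1 i hi).1 _ (hI.1 i hi).2

variable {E F G : Type*} [NormedAddCommGroup E] [NormedSpace ℝ E]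
  [NormedAddCommGroup F] [NormedSpace ℝ F] [NormedAddCommGroup G] [NormedSpace ℝ G]

theorem AbsolutelyContinuousOnInterval.bilinear (L : E →L[ℝ] F →L[ℝ] G) {u : ℝ → E} {v : ℝ → F}
    (hu : AbsolutelyContinuousOnInterval u a b) (hv : AbsolutelyContinuousOnInterval v a b) :
    AbsolutelyContinuousOnInterval (fun t ↦ L (u t) (v t)) a b := by
  obtain ⟨C, hC⟩ := hu.exists_bound
  obtain ⟨D, hD⟩ := hv.exists_bound
  refine AbsolutelyContinuousOnInterval.of_dist_le (C := ‖L‖ * D) (D := ‖L‖ * C) hu hv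
    fun x hx y hy ↦ ?_
  have hsplit : L (u x) (v x) - L (u y) (v y) = L (u x - u y) (v x) + L (u y) (v x - v y) := by
    simp
  rw [dist_eq_norm, dist_eq_norm, dist_eq_norm, hsplit]
  refine (norm_add_le _ _).trans (add_le_add ?_ ?_)
  · calc _ ≤ ‖L‖ * ‖u x - u y‖ * ‖v x‖ := L.le_opNorm₂ _ _
      _ ≤ ‖L‖ * ‖u x - u y‖ * D := by gcongr; exact hD x hx
      _ = _ := by ring
  · calc _ ≤ ‖L‖ * ‖u y‖ * ‖v x - v y‖ := L.le_opNorm₂ _ _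
      _ ≤ _ := by gcongr; exact hC y hy

theorem IntervalIntegrable.absolutelyContinuousOnInterval_primitive {φ : ℝ → E}
    (hφ : IntervalIntegrable φ volume a b) {c : ℝ} (hc : c ∈ Set.uIcc a b) :
    AbsolutelyContinuousOnInterval (fun t ↦ ∫ s in c..t, φ s) a b := by
  have hN := hφ.norm.absolutelyContinuousOnInterval_intervalIntegral hc
  refine AbsolutelyContinuousOnInterval.of_dist_le (C := 1) (D := 0) hN hN fun x hx y hy ↦ ?_
  have hcx := hφ.mono_set (Set.uIcc_subset_uIcc hc hx)
  have hcy := hφ.mono_set (Set.uIcc_subset_uIcc hc hy)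
  rw [zero_mul, add_zero, one_mul, dist_eq_norm, Real.dist_eq, integral_interval_sub_left hcx hcy,
    integral_interval_sub_left hcx.norm hcy.norm]
  exact norm_integral_le_abs_integral_norm

theorem AbsolutelyContinuousOnInterval.integral_eq_sub_of_ae_hasDerivAt {f f' : ℝ → ℝ}
    (hf : AbsolutelyContinuousOnInterval f a b)
    (hf' : ∀ᵐ x, x ∈ Set.uIcc a b → HasDerivAt f (f' x) x) :
    ∫ x in a..b, f' x = f b - f a := by
  rw [← hf.integral_deriv_eq_sub]
  refine integral_congr_ae ?_
  filter_upwards [hf'] with x hx hxab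
  exact (hx (Set.uIoc_subset_uIcc hxab)).deriv.symm

end

section
variable {E : Type*} [NormedAddCommGroup E] [InnerProductSpace ℝ E] {a b : ℝ}

theorem AbsolutelyContinuousOnInterval.inner {u v : ℝ → E}
    (hu : AbsolutelyContinuousOnInterval u a b) (hv : AbsolutelyContinuousOnInterval v a b) :
    AbsolutelyContinuousOnInterval (fun t ↦ ⟪u t, v t⟫) a b :=
  hu.bilinear (innerSL ℝ) hv

theorem IntervalIntegrable.inner_continuousOn {φ u : ℝ → E} (hφ : IntervalIntegrable φ volume a b)
    (hu : ContinuousOn u (Set.uIcc a b)) :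
    IntervalIntegrable (fun t ↦ ⟪u t, φ t⟫) volume a b := by
  obtain ⟨C, hC⟩ := isCompact_uIcc.exists_bound_of_continuousOn hu
  refine (hφ.norm.const_mul C).mono_fun ?_ ?_
  · exact ((hu.mono Set.uIoc_subset_uIcc).aestronglyMeasurable measurableSet_uIoc).inner
      hφ.def'.aestronglyMeasurable
  · refine (ae_restrict_mem measurableSet_uIoc).mono fun t ht ↦ ?_
    refine (norm_inner_le_norm _ _).trans (le_trans ?_ (le_abs_self _))
    gcongr
    exact hC t (Set.uIoc_subset_uIcc ht)

variable [CompleteSpace E]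

theorem norm_sq_integral_le {φ : ℝ → E} (hab : a ≤ b) (hφ : IntervalIntegrable φ volume a b)
    (hφ2 : IntervalIntegrable (fun t ↦ ‖φ t‖ ^ 2) volume a b) :
    ‖∫ t in a..b, φ t‖ ^ 2 ≤ (b - a) * ∫ t in a..b, ‖φ t‖ ^ 2 := by
  rcases hab.eq_or_lt with rfl | hlt
  · simp
  set v := ∫ t in a..b, φ t with hv
  have hin : ∫ t in a..b, ⟪v, φ t⟫ = ‖v‖ ^ 2 := by
    rw [← real_inner_self_eq_norm_sq]
    exact ((innerSL ℝ v).intervalIntegral_comp_comm hφ)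
  have hvφ : IntervalIntegrable (fun t ↦ ⟪v, φ t⟫) volume a b :=
    hφ.inner_continuousOn continuousOn_const
  have hnn : 0 ≤ ∫ t in a..b, ‖(b - a) • φ t - v‖ ^ 2 :=
    integral_nonneg hab fun t _ ↦ by positivity
  have hexp : ∀ t, ‖(b - a) • φ t - v‖ ^ 2
      = (b - a) ^ 2 * ‖φ t‖ ^ 2 - 2 * (b - a) * ⟪v, φ t⟫ + ‖v‖ ^ 2 := fun t ↦ by
    rw [norm_sub_sq_real, norm_smul, mul_pow, Real.norm_eq_abs, sq_abs, real_inner_smul_left,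
      real_inner_comm]
    ring
  simp_rw [hexp] at hnn
  rw [integral_add ((hφ2.const_mul _).sub (hvφ.const_mul _)) intervalIntegrable_const,
    integral_sub (hφ2.const_mul _) (hvφ.const_mul _), intervalIntegral.integral_const_mul,
    intervalIntegral.integral_const_mul, hin,
    intervalIntegral.integral_const, smul_eq_mul] at hnn
  have hpos := sub_pos.2 hlt
  refine le_of_mul_le_mul_left ?_ hpos
  nlinarith

/-- Integration by parts against a primitive that vanishes at the right endpoint. -/
theorem integral_inner_integral_left {g ψ : ℝ → E} (hg : IntervalIntegrable g volume a b)
    (hψ : IntervalIntegrable ψ volume a b) (hψ0 : ∫ t in a..b, ψ t = 0) :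
    ∫ t in a..b, ⟪∫ s in t..b, g s, ψ t⟫ = ∫ t in a..b, ⟪g t, ∫ s in a..t, ψ s⟫ := by
  have hK := hg.absolutelyContinuousOnInterval_primitive Set.right_mem_uIcc
  have hΨ := hψ.absolutelyContinuousOnInterval_primitive Set.left_mem_uIcc
  have key := (hK.inner hΨ).integral_eq_sub_of_ae_hasDerivAt
    (f' := fun t ↦ ⟪∫ s in b..t, g s, ψ t⟫ + ⟪g t, ∫ s in a..t, ψ s⟫) (by
      filter_upwards [hg.ae_hasDerivAt_integral, hψ.ae_hasDerivAt_integral] with t h1 h2 ht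
      exact (h1 ht b Set.right_mem_uIcc).inner ℝ (h2 ht a Set.left_mem_uIcc))
  have hint : IntervalIntegrable (fun t ↦ ⟪g t, ∫ s in a..t, ψ s⟫) volume a b := by
    simp_rw [real_inner_comm _ (g _)]
    exact hg.inner_continuousOn hΨ.continuousOn
  rw [integral_add (hψ.inner_continuousOn hK.continuousOn) hint] at key
  simp only [hψ0, integral_same, inner_zero_right, sub_zero] at key
  simp_rw [fun t ↦ integral_symm (f := g) (μ := volume) b t, inner_neg_left]
  rw [intervalIntegral.integral_neg]
  linarith

end

section
variable {E : Type*} [NormedAddCommGroup E] [InnerProductSpace ℝ E]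
  {F F' F'' R A : ℝ → E →L[ℝ] E} {φ : ℝ → E}

/-- `F' F⁻¹` blows up at most like `(1 - t)⁻¹` at a simple zero of `F`. -/
theorem eventually_norm_mul_inverse_le (hF : HasDerivAt F (-1) 1) (hF1 : F 1 = 0)
    (hF'1 : F' 1 = -1) (hF' : ContinuousAt F' 1)
    (hu : ∀ t ∈ Set.Ico (0 : ℝ) 1, IsUnit (F t)) :
    ∀ᶠ t in nhdsWithin (1 : ℝ) (Set.Iio 1), (1 - t) * ‖F' t * Ring.inverse (F t)‖ ≤ 4 := by
  have hbd : ∀ᶠ t in nhds (1 : ℝ), ‖F' t‖ < 2 := by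
    refine hF'.norm.eventually_lt continuousAt_const ?_
    rw [hF'1, norm_neg]
    exact ContinuousLinearMap.norm_id_le.trans_lt one_lt_two
  have hlin : ∀ᶠ t in nhds (1 : ℝ), ‖F t - F 1 - (t - 1) • (-1 : E →L[ℝ] E)‖ ≤ 1 / 2 * ‖t - 1‖ :=
    (hasDerivAt_iff_isLittleO.1 hF).def (by norm_num)
  have hIco : ∀ᶠ t in nhdsWithin (1 : ℝ) (Set.Iio 1), t ∈ Set.Ico (0 : ℝ) 1 :=
    Ico_mem_nhdsLT one_pos
  filter_upwards [hbd.filter_mono nhdsWithin_le_nhds, hlin.filter_mono nhdsWithin_le_nhds, hIco]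
    with t h1 h2 ht
  set A := F' t * Ring.inverse (F t)
  have hAF : A * F t = F' t := by
    rw [mul_assoc, Ring.inverse_mul_cancel _ (hu t ht), mul_one]
  have hpos : 0 < 1 - t := sub_pos.2 ht.2
  have habs : ‖t - 1‖ = 1 - t := by rw [norm_sub_rev, Real.norm_of_nonneg hpos.le]
  rw [hF1, sub_zero, habs] at h2
  have hdecomp : (1 - t) • A = F' t - A * (F t - (t - 1) • (-1 : E →L[ℝ] E)) := by
    rw [mul_sub, hAF, mul_smul_comm, mul_neg, mul_one, smul_neg, sub_neg_eq_add,
      sub_add_cancel_left, ← neg_smul, neg_sub]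
  have hle : (1 - t) * ‖A‖ ≤ 2 + ‖A‖ * (1 / 2 * (1 - t)) := by
    calc (1 - t) * ‖A‖ = ‖(1 - t) • A‖ := by rw [norm_smul, Real.norm_of_nonneg hpos.le]
      _ ≤ ‖F' t‖ + ‖A‖ * ‖F t - (t - 1) • (-1 : E →L[ℝ] E)‖ := by
        rw [hdecomp]
        exact (norm_sub_le _ _).trans (by gcongr; exact norm_mul_le _ _)
      _ ≤ _ := by gcongr
  linarith

variable [CompleteSpace E]

/-- The logarithmic derivative `F' F⁻¹` of a solution of `F'' = -R F` solves the Riccati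
equation. -/
theorem hasDerivAt_riccati {t : ℝ} (hF : HasDerivAt F (F' t) t) (hF' : HasDerivAt F' (F'' t) t)
    (hu : IsUnit (F t)) (hODE : F'' t = -(R t * F t)) :
    HasDerivAt (fun s ↦ F' s * Ring.inverse (F s))
      (-R t - F' t * Ring.inverse (F t) * (F' t * Ring.inverse (F t))) t := by
  obtain ⟨x, hx⟩ := hu
  have hinv := hasFDerivAt_ringInverse (𝕜 := ℝ) x
  rw [hx] at hinv
  refine (hF'.mul (hinv.comp_hasDerivAt t hF)).congr_deriv ?_
  have hcancel : F t * Ring.inverse (F t) = 1 := Ring.mul_inverse_cancel _ ⟨x, hx⟩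
  simp only [_root_.neg_apply, ContinuousLinearMap.mulLeftRight_apply, hODE,
    ← Ring.inverse_unit, hx, Function.comp_apply, neg_mul, mul_neg, mul_assoc, hcancel, mul_one,
    sub_eq_add_neg]

/-- On a compact interval where the Riccati solution `A` is regular, completing the square. -/
theorem integral_norm_sub_sq_of_riccati {a b : ℝ} (hab : a ≤ b)
    (hA : ∀ t ∈ Set.Icc a b, HasDerivAt A (-R t - A t * A t) t)
    (hsymm : ∀ t ∈ Set.Icc a b, ∀ x y, ⟪A t x, y⟫ = ⟪x, A t y⟫)
    (hR : Continuous R) (hφ : IntervalIntegrable φ volume a b)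
    (hφ2 : IntervalIntegrable (fun t ↦ ‖φ t‖ ^ 2) volume a b) :
    IntervalIntegrable (fun t ↦ ‖φ t - A t (∫ s in a..t, φ s)‖ ^ 2) volume a b ∧
    ∫ t in a..b, ‖φ t - A t (∫ s in a..t, φ s)‖ ^ 2
      = (∫ t in a..b, ‖φ t‖ ^ 2) - (∫ t in a..b, ⟪R t (∫ s in a..t, φ s), ∫ s in a..t, φ s⟫)
        - ⟪A b (∫ s in a..b, φ s), ∫ s in a..b, φ s⟫ := by
  set Φ : ℝ → E := fun t ↦ ∫ s in a..t, φ s 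
  rw [← Set.uIcc_of_le hab] at hA hsymm
  have hΦ : AbsolutelyContinuousOnInterval Φ a b :=
    hφ.absolutelyContinuousOnInterval_primitive Set.left_mem_uIcc
  have hΦc := hΦ.continuousOn
  have hAc : ContinuousOn A (Set.uIcc a b) := fun t ht ↦ (hA t ht).continuousAt.continuousWithinAt
  have hA'c : ContinuousOn (fun t ↦ -R t - A t * A t) (Set.uIcc a b) :=
    hR.continuousOn.neg.sub (hAc.mul hAc)
  have hAac : AbsolutelyContinuousOnInterval A a b := by
    obtain ⟨C, hC⟩ := isCompact_uIcc.exists_bound_of_continuousOn hA'c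
    refine LipschitzOnWith.absolutelyContinuousOnInterval (K := C.toNNReal) ?_
    refine (convex_uIcc a b).lipschitzOnWith_of_nnnorm_hasDerivWithin_le
      (fun t ht ↦ (hA t ht).hasDerivWithinAt) fun t ht ↦ ?_
    rw [← NNReal.coe_le_coe, coe_nnnorm]
    exact (hC t ht).trans (Real.le_coe_toNNReal C)
  have hAΦ : AbsolutelyContinuousOnInterval (fun t ↦ A t (Φ t)) a b :=
    hAac.bilinear (ContinuousLinearMap.id ℝ (E →L[ℝ] E)) hΦ
  have hAΦc := hAΦ.continuousOn
  have hRΦ : IntervalIntegrable (fun t ↦ ⟪R t (Φ t), Φ t⟫) volume a b :=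
    ((hR.continuousOn.clm_apply hΦc).inner hΦc).intervalIntegrable
  have hAφ : IntervalIntegrable (fun t ↦ ⟪A t (Φ t), φ t⟫) volume a b :=
    hφ.inner_continuousOn hAΦc
  have hAΦ2 : IntervalIntegrable (fun t ↦ ‖A t (Φ t)‖ ^ 2) volume a b :=
    (hAΦc.norm.pow 2).intervalIntegrable
  have hexp : ∀ t, ‖φ t - A t (Φ t)‖ ^ 2
      = ‖φ t‖ ^ 2 - 2 * ⟪A t (Φ t), φ t⟫ + ‖A t (Φ t)‖ ^ 2 := fun t ↦ by
    rw [norm_sub_sq_real, real_inner_comm]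
  have key := (hAΦ.inner hΦ).integral_eq_sub_of_ae_hasDerivAt
    (f' := fun t ↦ 2 * ⟪A t (Φ t), φ t⟫ - ⟪R t (Φ t), Φ t⟫ - ‖A t (Φ t)‖ ^ 2) (by
      filter_upwards [hφ.ae_hasDerivAt_integral] with t h ht
      have hΦt : HasDerivAt Φ (φ t) t := h ht a Set.left_mem_uIcc
      refine (((hA t ht).clm_apply hΦt).inner ℝ hΦt).congr_deriv ?_
      simp only [_root_.sub_apply, _root_.neg_apply,
        mul_apply_eq_comp, inner_add_left, inner_sub_left, inner_neg_left,
        hsymm t ht (A t (Φ t)), real_inner_self_eq_norm_sq, hsymm t ht (φ t)]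
      rw [real_inner_comm (φ t)]
      ring)
  rw [integral_sub ((hAφ.const_mul 2).sub hRΦ) hAΦ2, integral_sub (hAφ.const_mul 2) hRΦ] at key
  have hΦa : Φ a = 0 := integral_same
  simp only [hΦa, inner_zero_right, sub_zero] at key
  change IntervalIntegrable (fun t ↦ ‖φ t - A t (Φ t)‖ ^ 2) volume a b ∧
    ∫ t in a..b, ‖φ t - A t (Φ t)‖ ^ 2 = (∫ t in a..b, ‖φ t‖ ^ 2)
      - (∫ t in a..b, ⟪R t (Φ t), Φ t⟫) - ⟪A b (Φ b), Φ b⟫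
  simp_rw [hexp]
  refine ⟨(hφ2.sub (hAφ.const_mul 2)).add hAΦ2, ?_⟩
  rw [integral_add (hφ2.sub (hAφ.const_mul 2)) hAΦ2, integral_sub hφ2 (hAφ.const_mul 2)]
  linarith

end

section
variable {E : Type*} [NormedAddCommGroup E] [InnerProductSpace ℝ E] [CompleteSpace E]
  {R A : ℝ → E →L[ℝ] E} {φ : ℝ → E}

theorem tendsto_inner_boundary {C : ℝ}
    (hA : ∀ᶠ t in nhdsWithin (1 : ℝ) (Set.Iio 1), (1 - t) * ‖A t‖ ≤ C)
    (hφ : IntervalIntegrable φ volume 0 1)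
    (hφ2 : IntervalIntegrable (fun t ↦ ‖φ t‖ ^ 2) volume 0 1) (hφ0 : ∫ t in (0 : ℝ)..1, φ t = 0) :
    Filter.Tendsto (fun t ↦ ⟪A t (∫ s in (0 : ℝ)..t, φ s), ∫ s in (0 : ℝ)..t, φ s⟫)
      (nhdsWithin (1 : ℝ) (Set.Iio 1)) (nhds 0) := by
  have htail : Filter.Tendsto (fun t ↦ ∫ s in t..1, ‖φ s‖ ^ 2)
      (nhdsWithin (1 : ℝ) (Set.Iio 1)) (nhds 0) := by
    have hc := (hφ2.absolutelyContinuousOnInterval_primitive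
      (c := 1) Set.right_mem_uIcc).continuousOn 1 Set.right_mem_uIcc
    have hle : nhdsWithin (1 : ℝ) (Set.Iio 1) ≤ nhdsWithin 1 (Set.uIcc 0 1) := by
      rw [Set.uIcc_of_le zero_le_one, nhdsWithin_le_iff]
      exact Filter.mem_of_superset (Ico_mem_nhdsLT one_pos) Set.Ico_subset_Icc_self
    have h := (hc.mono_left hle).neg
    simp only [integral_same, neg_zero] at h
    exact h.congr fun t ↦ (integral_symm 1 t).symm
  have hIco : ∀ᶠ t in nhdsWithin (1 : ℝ) (Set.Iio 1), t ∈ Set.Ico (0 : ℝ) 1 :=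
    Ico_mem_nhdsLT one_pos
  refine squeeze_zero_norm' ?_ (by simpa using htail.const_mul C)
  filter_upwards [hA, hIco] with t hAt ht
  have ht' : t ∈ Set.uIcc (0 : ℝ) 1 := Set.Icc_subset_uIcc ⟨ht.1, ht.2.le⟩
  have h0t := Set.uIcc_subset_uIcc Set.left_mem_uIcc ht'
  have ht1 := Set.uIcc_subset_uIcc ht' Set.right_mem_uIcc
  have hadd := integral_add_adjacent_intervals (hφ.mono_set h0t) (hφ.mono_set ht1)
  have hCS := norm_sq_integral_le ht.2.le (hφ.mono_set ht1) (hφ2.mono_set ht1)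
  have hnorm : ‖∫ s in (0 : ℝ)..t, φ s‖ = ‖∫ s in t..1, φ s‖ := by
    rw [eq_neg_of_add_eq_zero_left (hadd.trans hφ0), norm_neg]
  have hnn : 0 ≤ ∫ s in t..1, ‖φ s‖ ^ 2 := integral_nonneg ht.2.le fun s _ ↦ by positivity
  calc _ ≤ ‖A t (∫ s in (0 : ℝ)..t, φ s)‖ * ‖∫ s in (0 : ℝ)..t, φ s‖ := norm_inner_le_norm _ _
    _ ≤ ‖A t‖ * ‖∫ s in (0 : ℝ)..t, φ s‖ * ‖∫ s in (0 : ℝ)..t, φ s‖ := by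
      gcongr
      exact (A t).le_opNorm _
    _ = ‖A t‖ * ‖∫ s in t..1, φ s‖ ^ 2 := by rw [hnorm]; ring
    _ ≤ ‖A t‖ * ((1 - t) * ∫ s in t..1, ‖φ s‖ ^ 2) := by gcongr
    _ = (1 - t) * ‖A t‖ * ∫ s in t..1, ‖φ s‖ ^ 2 := by ring
    _ ≤ _ := by gcongr

theorem integral_norm_sub_sq_eq {C : ℝ}
    (hA : ∀ t ∈ Set.Ico (0 : ℝ) 1, HasDerivAt A (-R t - A t * A t) t)
    (hsymm : ∀ t ∈ Set.Ico (0 : ℝ) 1, ∀ x y, ⟪A t x, y⟫ = ⟪x, A t y⟫)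
    (hAC : ∀ᶠ t in nhdsWithin (1 : ℝ) (Set.Iio 1), (1 - t) * ‖A t‖ ≤ C)
    (hR : Continuous R) (hφ : IntervalIntegrable φ volume 0 1)
    (hφ2 : IntervalIntegrable (fun t ↦ ‖φ t‖ ^ 2) volume 0 1) (hφ0 : ∫ t in (0 : ℝ)..1, φ t = 0) :
    ∫ t in (0 : ℝ)..1, ‖φ t - A t (∫ s in (0 : ℝ)..t, φ s)‖ ^ 2
      = (∫ t in (0 : ℝ)..1, ‖φ t‖ ^ 2)
        - ∫ t in (0 : ℝ)..1, ⟪R t (∫ s in (0 : ℝ)..t, φ s), ∫ s in (0 : ℝ)..t, φ s⟫ := by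
  set b : ℕ → ℝ := fun k ↦ 1 - 1 / ((k : ℝ) + 1)
  have hb : ∀ k, b k ∈ Set.Ico (0 : ℝ) 1 := fun k ↦
    ⟨sub_nonneg.2 (div_le_one_of_le₀ (by simp) (by positivity)),
      sub_lt_self _ (by positivity)⟩
  have hblim : Filter.Tendsto b Filter.atTop (nhds 1) := by
    simpa only [sub_zero] using
      (tendsto_one_div_add_atTop_nhds_zero_nat (𝕜 := ℝ)).const_sub (1 : ℝ)
  have hblim' : Filter.Tendsto b Filter.atTop (nhdsWithin 1 (Set.Iio 1)) :=
    tendsto_nhdsWithin_iff.2 ⟨hblim, Filter.Eventually.of_forall fun k ↦ (hb k).2⟩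
  have hsub : ∀ k, Set.uIcc 0 (b k) ⊆ Set.uIcc (0 : ℝ) 1 := fun k ↦
    Set.uIcc_subset_uIcc Set.left_mem_uIcc (Set.Icc_subset_uIcc ⟨(hb k).1, (hb k).2.le⟩)
  have hloc := fun k ↦ integral_norm_sub_sq_of_riccati (hb k).1
    (fun t ht ↦ hA t ⟨ht.1, ht.2.trans_lt (hb k).2⟩)
    (fun t ht ↦ hsymm t ⟨ht.1, ht.2.trans_lt (hb k).2⟩) hR (hφ.mono_set (hsub k))
    (hφ2.mono_set (hsub k))
  have hΦc := (hφ.absolutelyContinuousOnInterval_primitive Set.left_mem_uIcc).continuousOn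
  have hRΦ : IntervalIntegrable
      (fun t ↦ ⟪R t (∫ s in (0 : ℝ)..t, φ s), ∫ s in (0 : ℝ)..t, φ s⟫) volume 0 1 :=
    ((hR.continuousOn.clm_apply hΦc).inner hΦc).intervalIntegrable
  have hlim : ∀ {g : ℝ → ℝ}, IntervalIntegrable g volume 0 1 → Filter.Tendsto
      (fun k ↦ ∫ t in (0 : ℝ)..b k, g t) Filter.atTop (nhds (∫ t in (0 : ℝ)..1, g t)) := by
    intro g hg
    refine ((hg.absolutelyContinuousOnInterval_primitive Set.left_mem_uIcc).continuousOn 1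
      Set.right_mem_uIcc).tendsto.comp (tendsto_nhdsWithin_iff.2 ⟨hblim, ?_⟩)
    exact Filter.Eventually.of_forall fun k ↦ Set.Icc_subset_uIcc ⟨(hb k).1, (hb k).2.le⟩
  have htot := ((hlim hφ2).sub (hlim hRΦ)).sub ((tendsto_inner_boundary hAC hφ hφ2 hφ0).comp hblim')
  rw [sub_zero] at htot
  have hrestrict : ∀ k, (volume.restrict (Set.Ioc (0 : ℝ) 1)).restrict (Set.Ioc 0 (b k))
      = volume.restrict (Set.Ioc 0 (b k)) := fun k ↦
    Measure.restrict_restrict_of_subset (Set.Ioc_subset_Ioc_right (hb k).2.le)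
  rw [integral_of_le zero_le_one]
  refine (aecover_Ioc_of_Ioc tendsto_const_nhds hblim).integral_eq_of_tendsto_of_nonneg_ae _
    (Filter.Eventually.of_forall fun t ↦ by positivity) (fun k ↦ ?_) (htot.congr fun k ↦ ?_)
  · rw [IntegrableOn, hrestrict]
    exact (hloc k).1.1
  · rw [hrestrict, ← integral_of_le (hb k).1, (hloc k).2]
    rfl

theorem integral_inner_hessian {ψ : ℝ → E} (hR : Continuous R)
    (hφ : IntervalIntegrable φ volume 0 1) (hψ : IntervalIntegrable ψ volume 0 1)
    (hψ0 : ∫ t in (0 : ℝ)..1, ψ t = 0) (c : E) :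
    IntervalIntegrable (fun t ↦
      ⟪-(∫ s in t..1, R s (∫ u in (0 : ℝ)..s, φ u)) + c, ψ t⟫) volume 0 1 ∧
    ∫ t in (0 : ℝ)..1, ⟪-(∫ s in t..1, R s (∫ u in (0 : ℝ)..s, φ u)) + c, ψ t⟫
      = -∫ t in (0 : ℝ)..1, ⟪R t (∫ u in (0 : ℝ)..t, φ u), ∫ u in (0 : ℝ)..t, ψ u⟫ := by
  have hg : IntervalIntegrable (fun s ↦ R s (∫ u in (0 : ℝ)..s, φ u)) volume 0 1 :=
    (hR.continuousOn.clm_apply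
      (hφ.absolutelyContinuousOnInterval_primitive Set.left_mem_uIcc).continuousOn).intervalIntegrable
  have hK := (hg.absolutelyContinuousOnInterval_primitive Set.right_mem_uIcc).continuousOn
  have h1 : IntervalIntegrable
      (fun t ↦ ⟪∫ s in t..1, R s (∫ u in (0 : ℝ)..s, φ u), ψ t⟫) volume 0 1 := by
    refine hψ.inner_continuousOn (hK.neg.congr fun t _ ↦ ?_)
    exact integral_symm 1 t
  have h2 : IntervalIntegrable (fun t ↦ ⟪c, ψ t⟫) volume 0 1 :=
    hψ.inner_continuousOn continuousOn_const
  have hc : ∫ t in (0 : ℝ)..1, ⟪c, ψ t⟫ = 0 := by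
    refine ((innerSL ℝ c).intervalIntegral_comp_comm hψ).trans ?_
    rw [hψ0, map_zero]
  simp_rw [inner_add_left, inner_neg_left]
  have h1' : IntervalIntegrable
      (fun t ↦ -⟪∫ s in t..1, R s (∫ u in (0 : ℝ)..s, φ u), ψ t⟫) volume 0 1 := h1.neg
  refine ⟨h1'.add h2, ?_⟩
  rw [integral_add h1' h2, intervalIntegral.integral_neg, hc, add_zero,
    integral_inner_integral_left hg hψ hψ0]

end

section
variable {n : ℕ}

/-- `Matrix.toEuclideanCLM` as a continuous linear map for the sup norm on matrices. -/
def toEuclideanCLML (n : ℕ) : Matrix (Fin n) (Fin n) ℝ →L[ℝ]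
    (EuclideanSpace ℝ (Fin n) →L[ℝ] EuclideanSpace ℝ (Fin n)) :=
  LinearMap.toContinuousLinearMap
    (Matrix.toEuclideanCLM (n := Fin n) (𝕜 := ℝ)).toAlgEquiv.toLinearMap

theorem toEuclideanCLML_mul (M N : Matrix (Fin n) (Fin n) ℝ) :
    toEuclideanCLML n (M * N) = toEuclideanCLML n M * toEuclideanCLML n N :=
  map_mul (Matrix.toEuclideanCLM (n := Fin n) (𝕜 := ℝ)) M N

theorem toEuclideanCLML_one : toEuclideanCLML n 1 = 1 :=
  map_one (Matrix.toEuclideanCLM (n := Fin n) (𝕜 := ℝ))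

theorem isUnit_toEuclideanCLML {M : Matrix (Fin n) (Fin n) ℝ} (hM : IsUnit M) :
    IsUnit (toEuclideanCLML n M) :=
  hM.map (Matrix.toEuclideanCLM (n := Fin n) (𝕜 := ℝ))

theorem toEuclideanCLML_inv {M : Matrix (Fin n) (Fin n) ℝ} (hM : IsUnit M) :
    toEuclideanCLML n M⁻¹ = Ring.inverse (toEuclideanCLML n M) := by
  rw [← one_mul (Ring.inverse _),
    Ring.eq_mul_inverse_iff_mul_eq _ _ _ (isUnit_toEuclideanCLML hM), ← toEuclideanCLML_mul,
    Matrix.nonsing_inv_mul _ ((Matrix.isUnit_iff_isUnit_det _).1 hM), toEuclideanCLML_one]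

theorem inner_toEuclideanCLML_of_isSymm {M : Matrix (Fin n) (Fin n) ℝ} (hM : M.IsSymm)
    (x y : EuclideanSpace ℝ (Fin n)) :
    ⟪toEuclideanCLML n M x, y⟫ = ⟪x, toEuclideanCLML n M y⟫ := by
  change ⟪Matrix.toEuclideanCLM (n := Fin n) (𝕜 := ℝ) M x, y⟫
    = ⟪x, Matrix.toEuclideanCLM (n := Fin n) (𝕜 := ℝ) M y⟫
  rw [real_inner_comm, Matrix.inner_toEuclideanCLM, Matrix.inner_toEuclideanCLM,
    Matrix.dotProduct_mulVec, ← Matrix.mulVec_transpose, hM.eq, dotProduct_comm]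

theorem Sop_eq (f f' : ℝ → Matrix (Fin n) (Fin n) ℝ) (φ : ℝ → EuclideanSpace ℝ (Fin n)) (t : ℝ) :
    Sop n f f' φ t = φ t - toEuclideanCLML n (f' t * (f t)⁻¹) (∫ s in (0 : ℝ)..t, φ s) :=
  rfl

theorem Thess_eq (R : ℝ → Matrix (Fin n) (Fin n) ℝ) (φ : ℝ → EuclideanSpace ℝ (Fin n)) (t : ℝ) :
    Thess n R φ t = -(∫ s in t..1, toEuclideanCLML n (R s) (∫ u in (0 : ℝ)..s, φ u))
      + ∫ t' in (0 : ℝ)..1, ∫ s in t'..1, toEuclideanCLML n (R s) (∫ u in (0 : ℝ)..s, φ u) :=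
  rfl

end

/-- Let `f` solve the matrix Jacobi equation `f'' + Rf = 0` on `[0,1]` with `f(1) = 0`,
`f'(1) = −I`, `f(t)` invertible for `t < 1`, `R` symmetric, and `f' f⁻¹` symmetric.
Then `T` is a symmetric operator on the mean-zero subspace `L²₀` and
`‖Sφ‖²_{L²} = ((I+T)φ, φ)_{L²}` for every `φ ∈ L²₀`; i.e. `S` is a square root of
`I + T = D₀²E(c_{x₀,y₀})` (transported to `L²₀`). -/
theorem S_is_square_root_of_hessian (n : ℕ)
    (f f' f'' R : ℝ → Matrix (Fin n) (Fin n) ℝ)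
    (hf : ∀ t, HasDerivAt f (f' t) t) (hf' : ∀ t, HasDerivAt f' (f'' t) t)
    (hinv : ∀ t ∈ Set.Ico (0:ℝ) 1, IsUnit (f t))
    (hf1 : f 1 = 0) (hf'1 : f' 1 = -1)
    (hRsymm : ∀ t ∈ Set.Icc (0:ℝ) 1, (R t).IsSymm)
    (hRcont : ∀ i j, Continuous fun t => R t i j)
    (hODE : ∀ t ∈ Set.Icc (0:ℝ) 1, f'' t = -(R t * f t))
    (hsymm : ∀ t ∈ Set.Ico (0:ℝ) 1, (f' t * (f t)⁻¹).IsSymm) :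
    (∀ φ ψ : ℝ → EuclideanSpace ℝ (Fin n),
      IntervalIntegrable φ volume 0 1 → IntervalIntegrable ψ volume 0 1 →
      (∫ t in (0:ℝ)..1, φ t) = 0 → (∫ t in (0:ℝ)..1, ψ t) = 0 →
      (∫ t in (0:ℝ)..1, ⟪Thess n R φ t, ψ t⟫) = ∫ t in (0:ℝ)..1, ⟪φ t, Thess n R ψ t⟫)
    ∧ (∀ φ : ℝ → EuclideanSpace ℝ (Fin n),
      IntervalIntegrable φ volume 0 1 →
      IntervalIntegrable (fun s => ‖φ s‖ ^ 2) volume 0 1 →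
      (∫ t in (0:ℝ)..1, φ t) = 0 →
      (∫ t in (0:ℝ)..1, ‖Sop n f f' φ t‖ ^ 2)
        = ∫ t in (0:ℝ)..1, ⟪φ t + Thess n R φ t, φ t⟫) := by
  have hR : Continuous fun t ↦ toEuclideanCLML n (R t) :=
    (toEuclideanCLML n).continuous.comp (continuous_matrix hRcont)
  constructor
  · intro φ ψ hφ hψ hφ0 hψ0
    simp_rw [fun t ↦ real_inner_comm (Thess n R ψ t) (φ t), Thess_eq]
    rw [(integral_inner_hessian hR hφ hψ hψ0 _).2, (integral_inner_hessian hR hψ hφ hφ0 _).2]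
    refine congrArg Neg.neg (integral_congr fun t ht ↦ ?_)
    rw [Set.uIcc_of_le zero_le_one] at ht
    rw [inner_toEuclideanCLML_of_isSymm (hRsymm t ht), real_inner_comm]
  · intro φ hφ hφ2 hφ0
    have hL : ∀ {g g' : ℝ → Matrix (Fin n) (Fin n) ℝ} {t : ℝ}, HasDerivAt g (g' t) t →
        HasDerivAt (fun s ↦ toEuclideanCLML n (g s)) (toEuclideanCLML n (g' t)) t :=
      fun h ↦ (toEuclideanCLML n).hasFDerivAt.comp_hasDerivAt _ h
    have hu : ∀ t ∈ Set.Ico (0 : ℝ) 1, IsUnit (toEuclideanCLML n (f t)) :=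
      fun t ht ↦ isUnit_toEuclideanCLML (hinv t ht)
    have hA : ∀ t ∈ Set.Ico (0 : ℝ) 1, toEuclideanCLML n (f' t * (f t)⁻¹)
        = toEuclideanCLML n (f' t) * Ring.inverse (toEuclideanCLML n (f t)) := fun t ht ↦ by
      rw [toEuclideanCLML_mul, toEuclideanCLML_inv (hinv t ht)]
    have hF'1 : toEuclideanCLML n (f' 1) = -1 := by
      rw [hf'1, map_neg, toEuclideanCLML_one]
    have hric := fun t ht ↦ hasDerivAt_riccati (F := fun t ↦ toEuclideanCLML n (f t))
      (F' := fun t ↦ toEuclideanCLML n (f' t)) (F'' := fun t ↦ toEuclideanCLML n (f'' t))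
      (R := fun t ↦ toEuclideanCLML n (R t)) (hL (hf t)) (hL (hf' t)) (hu t ht) (by
        rw [hODE t (Set.Ico_subset_Icc_self ht), map_neg, toEuclideanCLML_mul])
    have hS := integral_norm_sub_sq_eq
      (A := fun t ↦ toEuclideanCLML n (f' t) * Ring.inverse (toEuclideanCLML n (f t)))
      (R := fun t ↦ toEuclideanCLML n (R t)) (C := 4)
      hric
      (fun t ht x y ↦ by
        rw [← hA t ht]
        exact inner_toEuclideanCLML_of_isSymm (hsymm t ht) x y)
      (eventually_norm_mul_inverse_le (F := fun t ↦ toEuclideanCLML n (f t))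
        (F' := fun t ↦ toEuclideanCLML n (f' t)) ((hL (hf 1)).congr_deriv hF'1)
        (by rw [hf1, map_zero]) hF'1
        (hL (hf' 1)).continuousAt hu)
      hR hφ hφ2 hφ0
    have hT := integral_inner_hessian hR hφ hφ hφ0
      (∫ t' in (0 : ℝ)..1, ∫ s in t'..1, toEuclideanCLML n (R s) (∫ u in (0 : ℝ)..s, φ u))
    simp_rw [← Thess_eq] at hT
    simp_rw [inner_add_left, real_inner_self_eq_norm_sq]
    rw [integral_add hφ2 hT.1, hT.2, ← sub_eq_add_neg, ← hS]
    refine integral_congr_ae ?_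
    filter_upwards [Measure.ae_ne volume (1 : ℝ)] with t ht1 ht
    rw [Set.uIoc_of_le zero_le_one] at ht
    rw [Sop_eq, hA t ⟨ht.1.le, ht.2.lt_of_ne ht1⟩]

end
end
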